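/- arXiv:1903.00845 — 2 statements merged into one kernel-verified Lean document; each statement's English description precedes it below -/
import Mathlib

section
/- The limit vectors v_even := lim_{n→∞} (c_1·c_3·⋯·c_{2n−1})^{−1}·(P_1·P_3·⋯·P_{2n−1}) e₉ and v_odd := lim_{n→∞} (c_2·c_4·⋯·c_{2n})^{−1}·(P_1·P_3·⋯·P_{2n−1}) e₂ exist in ℝ⁹, are nonzero, and are not scalar multiples of each other (i.e., v_even and v_odd are linearly independent). -/
open Filter Finset Matrix

/-- The golden ratio φ = (1+√5)/2. -/
noncomputable def goldphi : ℝ := (1 + Real.sqrt 5) / 2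

/-- The matrix `A`: identity in rows 1–7, row 8 = (0,0,0,0,0,1,1,1,1),
row 9 = (0,0,0,1,1,2,0,1,2). -/
def Amat : Matrix (Fin 9) (Fin 9) ℝ :=
  !![1,0,0,0,0,0,0,0,0;
     0,1,0,0,0,0,0,0,0;
     0,0,1,0,0,0,0,0,0;
     0,0,0,1,0,0,0,0,0;
     0,0,0,0,1,0,0,0,0;
     0,0,0,0,0,1,0,0,0;
     0,0,0,0,0,0,1,0,0;
     0,0,0,0,0,1,1,1,1;
     0,0,0,1,1,2,0,1,2]

/-- The matrix `M` with rows e₆, e₉, e₈, e₂, e₄+e₅, e₇, e₁+e₃, e₃, e₄. -/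
def Mmat : Matrix (Fin 9) (Fin 9) ℝ :=
  !![0,0,0,0,0,1,0,0,0;
     0,0,0,0,0,0,0,0,1;
     0,0,0,0,0,0,0,1,0;
     0,1,0,0,0,0,0,0,0;
     0,0,0,1,1,0,0,0,0;
     0,0,0,0,0,0,1,0,0;
     1,0,1,0,0,0,0,0,0;
     0,0,1,0,0,0,0,0,0;
     0,0,0,1,0,0,0,0,0]

/-- The rank-one limit matrix `L`, nonzero only in rows 2 and 3. -/
noncomputable def Lmat : Matrix (Fin 9) (Fin 9) ℝ :=
  !![0,0,0,0,0,0,0,0,0;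
     (Real.sqrt 5 - 1)/4, 1/2, (1 + Real.sqrt 5)/4, (3 + Real.sqrt 5)/4, 1/2, 0, (3 + Real.sqrt 5)/4, 0, 0;
     (3 - Real.sqrt 5)/4, (Real.sqrt 5 - 1)/4, 1/2, (1 + Real.sqrt 5)/4, (Real.sqrt 5 - 1)/4, 0, (1 + Real.sqrt 5)/4, 0, 0;
     0,0,0,0,0,0,0,0,0;
     0,0,0,0,0,0,0,0,0;
     0,0,0,0,0,0,0,0,0;
     0,0,0,0,0,0,0,0,0;
     0,0,0,0,0,0,0,0,0;
     0,0,0,0,0,0,0,0,0]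

/-- `a_i = r_i - 1`. -/
def aseq (r : ℕ → ℕ) (i : ℕ) : ℕ := r i - 1

/-- `c_i = (2/√5)·φ^{2 a_i}`. -/
noncomputable def cseq (r : ℕ → ℕ) (i : ℕ) : ℝ :=
  (2 / Real.sqrt 5) * goldphi ^ (2 * aseq r i)

/-- `P_i = A^{a_i} M A^{a_{i+1}} M`. -/
noncomputable def Pmat (r : ℕ → ℕ) (i : ℕ) : Matrix (Fin 9) (Fin 9) ℝ :=
  Amat ^ (aseq r i) * Mmat * Amat ^ (aseq r (i+1)) * Mmat

/-- `R_i = P_i / c_{i+1}`. -/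
noncomputable def Rmat (r : ℕ → ℕ) (i : ℕ) : Matrix (Fin 9) (Fin 9) ℝ :=
  (cseq r (i+1))⁻¹ • Pmat r i

/-- The Frobenius norm of a square real matrix. -/
noncomputable def frobNorm {n : ℕ} (X : Matrix (Fin n) (Fin n) ℝ) : ℝ :=
  Real.sqrt (∑ i, ∑ j, (X i j)^2)

/-- The hypotheses on the sequence `r`: `r 1 = 1`, `r 2 = 2`, and the sequence of
differences `n ↦ r (n+1) - r n` (for `n ≥ 1`) is strictly increasing. -/
def GoodSeq (r : ℕ → ℕ) : Prop :=
  r 1 = 1 ∧ r 2 = 2 ∧ ∀ n, 1 ≤ n → r (n+1) - r n < r (n+2) - r (n+1)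


/-! ### Abstract convergence of products of perturbed idempotents -/

/-- The product `T N * T (N+1) * ... * T (N+k-1)`. -/
def tailProd {R : Type*} [Monoid R] (T : ℕ → R) (N k : ℕ) : R :=
  ((List.range k).map (fun l => T (N + l))).prod

theorem tailProd_zero {R : Type*} [Monoid R] (T : ℕ → R) (N : ℕ) : tailProd T N 0 = 1 := by
  simp [tailProd]

theorem tailProd_succ {R : Type*} [Monoid R] (T : ℕ → R) (N k : ℕ) :
    tailProd T N (k+1) = tailProd T N k * T (N + k) := by
  simp [tailProd, List.range_succ]

theorem tailProd_add {R : Type*} [Monoid R] (T : ℕ → R) (N k : ℕ) :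
    tailProd T 0 (N + k) = tailProd T 0 N * tailProd T N k := by
  induction k with
  | zero => simp [tailProd_zero]
  | succ k ih => rw [← add_assoc, tailProd_succ, ih, tailProd_succ, mul_assoc, zero_add]

theorem tailProd_bdd {R : Type*} [NormedRing R] (T : ℕ → R) (T₀ : R)
    (hid : T₀ * T₀ = T₀) (hs : Summable (fun l => ‖T l - T₀‖)) :
    ∃ B : ℝ, 0 ≤ B ∧ ∀ N k, ‖tailProd T N k‖ ≤ B := by
  set ε : ℕ → ℝ := fun l => ‖T l - T₀‖ with hε
  have hε0 : ∀ l, 0 ≤ ε l := fun l => norm_nonneg _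
  set K : ℝ := 1 + ‖T₀‖ with hK
  have hK1 : 1 ≤ K := by simp [hK]
  set m0 : ℝ := max ‖(1:R)‖ ‖T₀‖ with hm0
  have hm00 : 0 ≤ m0 := le_max_of_le_left (norm_nonneg _)
  have key : ∀ N k, max ‖tailProd T N k‖ ‖tailProd T N k * T₀‖
      ≤ m0 * Real.exp (K * ∑ l ∈ Finset.range k, ε (N + l)) := by
    intro N k
    induction k with
    | zero => simp [tailProd_zero, hm0]
    | succ k ih =>
      set Q := tailProd T N k with hQ
      set m := max ‖Q‖ ‖Q * T₀‖ with hm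
      have hQm : ‖Q‖ ≤ m := le_max_left _ _
      have hQTm : ‖Q * T₀‖ ≤ m := le_max_right _ _
      have hm_nn : 0 ≤ m := (norm_nonneg _).trans hQm
      have e0 := hε0 (N + k)
      have hE : ‖Q * (T (N+k) - T₀)‖ ≤ m * ε (N+k) :=
        (norm_mul_le _ _).trans (mul_le_mul_of_nonneg_right hQm e0)
      have h1 : ‖Q * T (N+k)‖ ≤ m * (1 + K * ε (N+k)) := by
        have : Q * T (N+k) = Q * T₀ + Q * (T (N+k) - T₀) := by noncomm_ring
        rw [this]
        refine (norm_add_le _ _).trans ?_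
        have : m * ε (N+k) ≤ m * (K * ε (N+k)) :=
          mul_le_mul_of_nonneg_left (le_mul_of_one_le_left e0 hK1) hm_nn
        linarith
      have h2 : ‖Q * T (N+k) * T₀‖ ≤ m * (1 + K * ε (N+k)) := by
        have : Q * T (N+k) * T₀ = Q * T₀ + Q * (T (N+k) - T₀) * T₀ := by
          rw [mul_sub, sub_mul, mul_assoc Q T₀ T₀, hid]; abel
        rw [this]
        refine (norm_add_le _ _).trans ?_
        have h3 : ‖Q * (T (N+k) - T₀) * T₀‖ ≤ (m * ε (N+k)) * ‖T₀‖ :=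
          (norm_mul_le _ _).trans (mul_le_mul_of_nonneg_right hE (norm_nonneg _))
        have h4 : (m * ε (N+k)) * ‖T₀‖ ≤ (m * ε (N+k)) * K :=
          mul_le_mul_of_nonneg_left (by simp [hK]) (mul_nonneg hm_nn e0)
        linarith
      rw [tailProd_succ, Finset.sum_range_succ, mul_add, Real.exp_add, ← mul_assoc]
      refine (max_le h1 h2).trans ?_
      have h5 : 1 + K * ε (N+k) ≤ Real.exp (K * ε (N+k)) := by
        have := Real.add_one_le_exp (K * ε (N+k)); linarith
      exact mul_le_mul ih h5 (by positivity) (by positivity)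
  refine ⟨m0 * Real.exp (K * ∑' l, ε l), by positivity, fun N k => ?_⟩
  refine (le_max_left _ _).trans ((key N k).trans ?_)
  refine mul_le_mul_of_nonneg_left (Real.exp_le_exp.2 (mul_le_mul_of_nonneg_left ?_ (by linarith)))
    hm00
  have h1 : ∑ l ∈ Finset.range k, ε (N + l) = ∑ l ∈ (Finset.range k).map (addLeftEmbedding N), ε l := by
    simp
  rw [h1]
  exact hs.sum_le_tsum _ (fun i _ => hε0 i)

theorem tailProd_tendsto {R : Type*} [NormedRing R] [CompleteSpace R] (T : ℕ → R) (T₀ : R)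
    (hid : T₀ * T₀ = T₀) (hs : Summable (fun l => ‖T l - T₀‖)) :
    ∃ W : ℕ → R, (∀ N, Tendsto (fun k => tailProd T N k) atTop (nhds (W N))) ∧
      Tendsto W atTop (nhds T₀) := by
  obtain ⟨B, hB0, hB⟩ := tailProd_bdd T T₀ hid hs
  have hd : ∀ N k, dist (tailProd T N k * T₀) (tailProd T N (k+1) * T₀)
      ≤ B * ‖T₀‖ * ‖T (k + N) - T₀‖ := by
    intro N k
    have : tailProd T N k * T₀ - tailProd T N (k+1) * T₀
        = - (tailProd T N k * (T (k + N) - T₀) * T₀) := by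
      rw [tailProd_succ, add_comm N k, mul_sub, sub_mul, mul_assoc _ T₀ T₀, hid]; abel
    rw [dist_eq_norm, this, norm_neg]
    calc _ ≤ ‖tailProd T N k‖ * ‖T (k + N) - T₀‖ * ‖T₀‖ :=
          (norm_mul_le _ _).trans (mul_le_mul_of_nonneg_right (norm_mul_le _ _) (norm_nonneg _))
      _ ≤ B * ‖T (k + N) - T₀‖ * ‖T₀‖ := by
          gcongr; exact hB N k
      _ = _ := by ring
  have hsN : ∀ N, Summable (fun k => B * ‖T₀‖ * ‖T (k + N) - T₀‖) := fun N =>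
    ((summable_nat_add_iff N).2 hs).mul_left _
  have hc : ∀ N, ∃ w, Tendsto (fun k => tailProd T N k * T₀) atTop (nhds w) := fun N =>
    cauchySeq_tendsto_of_complete (cauchySeq_of_dist_le_of_summable _ (hd N) (hsN N))
  choose W hW using hc
  refine ⟨W, fun N => ?_, ?_⟩
  · rw [← tendsto_add_atTop_iff_nat 1]
    have h0 : Tendsto (fun k => tailProd T N k * (T (k + N) - T₀)) atTop (nhds 0) := by
      refine squeeze_zero_norm (a := fun k => B * ‖T (k + N) - T₀‖) (fun k => ?_) ?_
      · exact (norm_mul_le _ _).trans (mul_le_mul_of_nonneg_right (hB N k) (norm_nonneg _))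
      · simpa using (((summable_nat_add_iff N).2 hs).mul_left B).tendsto_atTop_zero
    have := (hW N).add h0
    rw [add_zero] at this
    refine this.congr (fun k => ?_)
    rw [tailProd_succ, add_comm N k]; noncomm_ring
  · rw [tendsto_iff_dist_tendsto_zero]
    refine squeeze_zero (fun _ => dist_nonneg)
      (g := fun N => ∑' k, B * ‖T₀‖ * ‖T (k + N) - T₀‖) (fun N => ?_) ?_
    · have := dist_le_tsum_of_dist_le_of_tendsto₀ _ (hd N) (hsN N) (hW N)
      rw [tailProd_zero, one_mul, dist_comm] at this
      exact this
    · exact tendsto_sum_nat_add (fun k => B * ‖T₀‖ * ‖T k - T₀‖)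

/-- Matrix version, with entrywise hypotheses. -/
theorem tailProd_matrix (T : ℕ → Matrix (Fin 9) (Fin 9) ℝ) (T₀ : Matrix (Fin 9) (Fin 9) ℝ)
    (hid : T₀ * T₀ = T₀) (hs : ∀ i j, Summable (fun l => T l i j - T₀ i j)) :
    ∃ W : ℕ → Matrix (Fin 9) (Fin 9) ℝ,
      (∀ N i j, Tendsto (fun k => tailProd T N k i j) atTop (nhds (W N i j))) ∧
      ∀ i j, Tendsto (fun N => W N i j) atTop (nhds (T₀ i j)) := by
  let _nr := Matrix.linftyOpNormedRing (n := Fin 9) (α := ℝ)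
  have hle : ∀ X : Matrix (Fin 9) (Fin 9) ℝ, ‖X‖ ≤ ∑ i, ∑ j, |X i j| := by
    intro X
    have h := Matrix.linfty_opNorm_def X
    obtain ⟨i, -, hi⟩ := Finset.exists_mem_eq_sup (Finset.univ : Finset (Fin 9))
      Finset.univ_nonempty (fun i => ∑ j, ‖X i j‖₊)
    rw [h, hi]
    push_cast
    simp only [Real.norm_eq_abs]
    exact Finset.single_le_sum (f := fun i => ∑ j, |X i j|)
      (fun i _ => Finset.sum_nonneg (fun j _ => abs_nonneg _)) (Finset.mem_univ i)
  have hsum : Summable (fun l => ‖T l - T₀‖) := by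
    refine Summable.of_nonneg_of_le (fun _ => norm_nonneg _) (fun l => hle _) ?_
    refine summable_sum (fun i _ => summable_sum (fun j _ => ?_))
    exact (hs i j).abs
  let _ns := Matrix.linftyOpNormedSpace (m := Fin 9) (n := Fin 9) (R := ℝ) (α := ℝ)
  have hc := FiniteDimensional.complete ℝ (Matrix (Fin 9) (Fin 9) ℝ)
  obtain ⟨W, h1, h2⟩ := @tailProd_tendsto _ _ hc T T₀ hid hsum
  have hcont : ∀ i j, Continuous (fun X : Matrix (Fin 9) (Fin 9) ℝ => X i j) := by
    intro i j
    exact (continuous_apply_apply i j)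
  exact ⟨W, fun N i j => ((hcont i j).tendsto _).comp (h1 N),
    fun i j => ((hcont i j).tendsto _).comp h2⟩

/-! ### Explicit form of `Pmat` -/

theorem gold_sq : goldphi ^ 2 = goldphi + 1 := by
  have h : Real.sqrt 5 ^ 2 = 5 := Real.sq_sqrt (by norm_num)
  unfold goldphi; nlinarith

theorem sqrt5_eq : Real.sqrt 5 = 2 * goldphi - 1 := by unfold goldphi; ring

theorem gold_gt : 3/2 < goldphi := by
  have h : 2 < Real.sqrt 5 := by
    rw [Real.lt_sqrt (by norm_num)]; norm_num
  unfold goldphi; linarith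

/-- Constant part of `A^a`. -/
def A0 : Matrix (Fin 9) (Fin 9) ℝ :=
  !![1,0,0,0,0,0,0,0,0;
     0,1,0,0,0,0,0,0,0;
     0,0,1,0,0,0,0,0,0;
     0,0,0,1,0,0,0,0,0;
     0,0,0,0,1,0,0,0,0;
     0,0,0,0,0,1,0,0,0;
     0,0,0,0,0,0,1,0,0;
     0,0,0,-1,-1,-1,1,0,0;
     0,0,0,0,0,-1,-1,0,0]

/-- Growing part of `A^a`. -/
noncomputable def A1 : Matrix (Fin 9) (Fin 9) ℝ :=
  ((2 * goldphi - 1)/5) • Matrix.vecMulVec ![0,0,0,0,0,0,0,goldphi-1,1]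
    ![0,0,0,1,1,1+goldphi,goldphi-1,1,goldphi]

/-- Decaying part of `A^a`. -/
noncomputable def A2 : Matrix (Fin 9) (Fin 9) ℝ :=
  ((2 * goldphi - 1)/5) • Matrix.vecMulVec ![0,0,0,0,0,0,0,1,1-goldphi]
    ![0,0,0,goldphi,goldphi,goldphi-1,-1-goldphi,goldphi,-1]

set_option maxHeartbeats 2000000 in
theorem A_sum : A0 + A1 + A2 = 1 := by
  have h := gold_sq
  ext i j
  simp only [A1, A2, Matrix.add_apply, Matrix.smul_apply, Matrix.vecMulVec_apply]
  fin_cases i <;> fin_cases j <;>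
    simp [A0] <;> grind

theorem A0_A : A0 * Amat = A0 := by
  ext i j
  fin_cases i <;> fin_cases j <;>
    simp [A0, Amat, Matrix.mul_apply, Fin.sum_univ_succ]

theorem A1_A : A1 * Amat = goldphi ^ 2 • A1 := by
  have h := gold_sq
  have : Matrix.vecMul ![0,0,0,1,1,1+goldphi,goldphi-1,1,goldphi] Amat
      = goldphi ^ 2 • ![0,0,0,1,1,1+goldphi,goldphi-1,1,goldphi] := by
    ext j
    fin_cases j <;> simp [Amat, Matrix.vecMul, dotProduct, Fin.sum_univ_succ] <;> grind
  rw [A1, Matrix.smul_mul, Matrix.vecMulVec_mul, this, Matrix.vecMulVec_smul, smul_comm]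

theorem A2_A : A2 * Amat = (2 - goldphi) • A2 := by
  have h := gold_sq
  have : Matrix.vecMul ![0,0,0,goldphi,goldphi,goldphi-1,-1-goldphi,goldphi,-1] Amat
      = (2 - goldphi) • ![0,0,0,goldphi,goldphi,goldphi-1,-1-goldphi,goldphi,-1] := by
    ext j
    fin_cases j <;> simp [Amat, Matrix.vecMul, dotProduct, Fin.sum_univ_succ] <;> grind
  rw [A2, Matrix.smul_mul, Matrix.vecMulVec_mul, this, Matrix.vecMulVec_smul, smul_comm]

theorem A_pow (a : ℕ) :
    Amat ^ a = A0 + goldphi ^ (2 * a) • A1 + (goldphi ^ (2 * a))⁻¹ • A2 := by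
  have h2 : 2 - goldphi = (goldphi ^ 2)⁻¹ := by
    have h := gold_sq
    have : goldphi ^ 2 ≠ 0 := by have := gold_gt; positivity
    field_simp
    grind
  induction a with
  | zero => simp [A_sum]
  | succ a ih =>
    rw [pow_succ, ih, add_mul, add_mul, A0_A, Matrix.smul_mul, Matrix.smul_mul, A1_A, A2_A,
      smul_smul, smul_smul, h2]
    congr 3
    · ring
    · rw [← mul_inv]; ring_nf

/-- Constant part of `P`. -/
noncomputable def Zm : Matrix (Fin 9) (Fin 9) ℝ := A0 * Mmat * A0 * Mmat
/-- Coefficient of `φ^{2a_i}` in `P`. -/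
noncomputable def Um : Matrix (Fin 9) (Fin 9) ℝ :=
  ((2 * goldphi - 1)/5) • Matrix.vecMulVec ![0,0,0,0,0,0,0,goldphi-1,1]
    ![1+goldphi,1+goldphi,1+goldphi,1,1,goldphi-1,0,goldphi,1]
/-- Coefficient of `φ^{-2a_i}` in `P`. -/
noncomputable def Um' : Matrix (Fin 9) (Fin 9) ℝ := A2 * Mmat * A0 * Mmat
/-- Coefficient of `φ^{2a_{i+1}}` in `P`. -/
noncomputable def Vm : Matrix (Fin 9) (Fin 9) ℝ :=
  ((2 * goldphi - 1)/5) • Matrix.vecMulVec ![0,1,goldphi-1,0,0,0,0,0,0]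
    ![goldphi-1,1,goldphi,1+goldphi,1,0,1+goldphi,0,0]
/-- Coefficient of `φ^{-2a_{i+1}}` in `P`. -/
noncomputable def Vm' : Matrix (Fin 9) (Fin 9) ℝ := A0 * Mmat * A2 * Mmat

theorem A0M_u : (A0 * Mmat).mulVec ![0,0,0,0,0,0,0,goldphi-1,1] = ![0,1,goldphi-1,0,0,0,0,0,0] := by
  rw [← Matrix.mulVec_mulVec]
  have : Mmat.mulVec ![0,0,0,0,0,0,0,goldphi-1,1] = ![0,1,goldphi-1,0,0,0,0,0,0] := by
    ext j
    fin_cases j <;> simp [Mmat, Matrix.mulVec, dotProduct, Fin.sum_univ_succ]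
  rw [this]
  ext j
  fin_cases j <;> simp [A0, Matrix.mulVec, dotProduct, Fin.sum_univ_succ]

theorem A0M_u' : (A0 * Mmat).mulVec ![0,0,0,0,0,0,0,1,1-goldphi] = ![0,1-goldphi,1,0,0,0,0,0,0] := by
  rw [← Matrix.mulVec_mulVec]
  have : Mmat.mulVec ![0,0,0,0,0,0,0,1,1-goldphi] = ![0,1-goldphi,1,0,0,0,0,0,0] := by
    ext j
    fin_cases j <;> simp [Mmat, Matrix.mulVec, dotProduct, Fin.sum_univ_succ]
  rw [this]
  ext j
  fin_cases j <;> simp [A0, Matrix.mulVec, dotProduct, Fin.sum_univ_succ]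

theorem Vm_eq : A0 * Mmat * A1 * Mmat = Vm := by
  have : Matrix.vecMul ![0,0,0,1,1,1+goldphi,goldphi-1,1,goldphi] Mmat
      = ![goldphi-1,1,goldphi,1+goldphi,1,0,1+goldphi,0,0] := by
    ext j
    fin_cases j <;> simp [Mmat, Matrix.vecMul, dotProduct, Fin.sum_univ_succ] <;> ring
  rw [Vm, A1, Matrix.mul_smul, Matrix.smul_mul, Matrix.mul_vecMulVec, Matrix.vecMulVec_mul, A0M_u,
    this]

theorem Um_eq : A1 * Mmat * A0 * Mmat = Um := by
  have h1 : Matrix.vecMul ![0,0,0,1,1,1+goldphi,goldphi-1,1,goldphi] Mmat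
      = ![goldphi-1,1,goldphi,1+goldphi,1,0,1+goldphi,0,0] := by
    ext j
    fin_cases j <;> simp [Mmat, Matrix.vecMul, dotProduct, Fin.sum_univ_succ] <;> ring
  have h2 : Matrix.vecMul ![goldphi-1,1,goldphi,1+goldphi,1,0,1+goldphi,0,0] A0
      = ![goldphi-1,1,goldphi,1+goldphi,1,0,1+goldphi,0,0] := by
    ext j
    fin_cases j <;> simp [A0, Matrix.vecMul, dotProduct, Fin.sum_univ_succ]
  have h3 : Matrix.vecMul ![goldphi-1,1,goldphi,1+goldphi,1,0,1+goldphi,0,0] Mmat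
      = ![1+goldphi,1+goldphi,1+goldphi,1,1,goldphi-1,0,goldphi,1] := by
    ext j
    fin_cases j <;> simp [Mmat, Matrix.vecMul, dotProduct, Fin.sum_univ_succ] <;> ring
  rw [Um, A1, Matrix.smul_mul, Matrix.smul_mul, Matrix.smul_mul, Matrix.vecMulVec_mul,
    Matrix.vecMulVec_mul, Matrix.vecMulVec_mul, h1, h2, h3]

theorem A1M : A1 * Mmat = ((2 * goldphi - 1)/5) • Matrix.vecMulVec ![0,0,0,0,0,0,0,goldphi-1,1]
    ![goldphi-1,1,goldphi,1+goldphi,1,0,1+goldphi,0,0] := by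
  have : Matrix.vecMul ![0,0,0,1,1,1+goldphi,goldphi-1,1,goldphi] Mmat
      = ![goldphi-1,1,goldphi,1+goldphi,1,0,1+goldphi,0,0] := by
    ext j
    fin_cases j <;> simp [Mmat, Matrix.vecMul, dotProduct, Fin.sum_univ_succ] <;> ring
  rw [A1, Matrix.smul_mul, Matrix.vecMulVec_mul, this]

theorem A2M : A2 * Mmat = ((2 * goldphi - 1)/5) • Matrix.vecMulVec ![0,0,0,0,0,0,0,1,1-goldphi]
    ![-1-goldphi,goldphi,-1,goldphi-1,goldphi,0,goldphi-1,0,0] := by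
  have : Matrix.vecMul ![0,0,0,goldphi,goldphi,goldphi-1,-1-goldphi,goldphi,-1] Mmat
      = ![-1-goldphi,goldphi,-1,goldphi-1,goldphi,0,goldphi-1,0,0] := by
    ext j
    fin_cases j <;> simp [Mmat, Matrix.vecMul, dotProduct, Fin.sum_univ_succ] <;> ring
  rw [A2, Matrix.smul_mul, Matrix.vecMulVec_mul, this]

theorem A11 : A1 * Mmat * A1 = 0 := by
  rw [A1M, A1, Matrix.smul_mul, Matrix.mul_smul, Matrix.vecMulVec_mul, Matrix.vecMul_vecMulVec]
  simp [dotProduct, Fin.sum_univ_succ]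

theorem A12 : A1 * Mmat * A2 = 0 := by
  rw [A1M, A2, Matrix.smul_mul, Matrix.mul_smul, Matrix.vecMulVec_mul, Matrix.vecMul_vecMulVec]
  simp [dotProduct, Fin.sum_univ_succ]

theorem A21 : A2 * Mmat * A1 = 0 := by
  rw [A2M, A1, Matrix.smul_mul, Matrix.mul_smul, Matrix.vecMulVec_mul, Matrix.vecMul_vecMulVec]
  simp [dotProduct, Fin.sum_univ_succ]

theorem A22 : A2 * Mmat * A2 = 0 := by
  rw [A2M, A2, Matrix.smul_mul, Matrix.mul_smul, Matrix.vecMulVec_mul, Matrix.vecMul_vecMulVec]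
  simp [dotProduct, Fin.sum_univ_succ]

theorem P_apply (r : ℕ → ℕ) (n : ℕ) (i j : Fin 9) :
    Pmat r n i j = Zm i j + goldphi ^ (2 * aseq r n) * Um i j
      + (goldphi ^ (2 * aseq r n))⁻¹ * Um' i j + goldphi ^ (2 * aseq r (n+1)) * Vm i j
      + (goldphi ^ (2 * aseq r (n+1)))⁻¹ * Vm' i j := by
  have : Pmat r n = Zm + goldphi ^ (2 * aseq r n) • Um
      + (goldphi ^ (2 * aseq r n))⁻¹ • Um' + goldphi ^ (2 * aseq r (n+1)) • Vm
      + (goldphi ^ (2 * aseq r (n+1)))⁻¹ • Vm' := by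
    rw [Pmat, A_pow, A_pow, ← Um_eq, ← Vm_eq, Zm, Um', Vm']
    simp only [add_mul, mul_add, Matrix.smul_mul, Matrix.mul_smul, A11, A12, A21, A22]
    simp only [smul_zero, Matrix.zero_mul]
    abel
  rw [this]
  simp [Matrix.add_apply, Matrix.smul_apply]

theorem Um_zero (i j : Fin 9) (h : ¬ (i = 7 ∨ i = 8)) : Um i j = 0 := by
  simp only [Um, Matrix.smul_apply, Matrix.vecMulVec_apply]
  revert h; fin_cases i <;> simp

theorem Um'_zero (i j : Fin 9) (h : ¬ (i = 7 ∨ i = 8)) : Um' i j = 0 := by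
  simp only [Um', A2, Matrix.smul_mul, Matrix.vecMulVec_mul, Matrix.smul_apply,
    Matrix.vecMulVec_apply]
  revert h; fin_cases i <;> simp

theorem Vm_zero (i j : Fin 9) (h : ¬ (i = 1 ∨ i = 2)) : Vm i j = 0 := by
  simp only [Vm, Matrix.smul_apply, Matrix.vecMulVec_apply]
  revert h; fin_cases i <;> simp

theorem Vm'_zero (i j : Fin 9) (h : ¬ (i = 1 ∨ i = 2)) : Vm' i j = 0 := by
  simp only [Vm', A2, Matrix.smul_mul, Matrix.mul_smul, Matrix.mul_vecMulVec, A0M_u',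
    Matrix.vecMulVec_mul, Matrix.smul_apply, Matrix.vecMulVec_apply]
  revert h; fin_cases i <;> simp

theorem Vm_col (i j : Fin 9) (h : j = 7 ∨ j = 8) : Vm i j = 0 := by
  simp only [Vm, Matrix.smul_apply, Matrix.vecMulVec_apply]
  rcases h with rfl | rfl <;> simp

/-- Limit idempotent, even mode. -/
noncomputable def T0E : Matrix (Fin 9) (Fin 9) ℝ :=
  (1/2 : ℝ) • Matrix.vecMulVec ![0,0,0,0,0,0,0,goldphi-1,1] ![0,0,0,0,0,0,0,goldphi,1]

/-- Limit idempotent, odd mode. -/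
noncomputable def T0O : Matrix (Fin 9) (Fin 9) ℝ :=
  (1/2 : ℝ) • Matrix.vecMulVec ![0,1,goldphi-1,0,0,0,0,0,0] ![0,1,goldphi,0,0,0,0,0,0]

theorem T0E_idem : T0E * T0E = T0E := by
  have h := gold_sq
  have : ![0,0,0,0,0,0,0,goldphi,1] ⬝ᵥ ![0,0,0,0,0,0,0,goldphi-1,1] = 2 := by
    simp [dotProduct, Fin.sum_univ_succ]; grind
  rw [T0E, Matrix.smul_mul, Matrix.mul_smul, Matrix.vecMulVec_mul, Matrix.vecMul_vecMulVec, this,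
    Matrix.vecMulVec_smul, smul_smul, smul_smul]
  norm_num

theorem T0O_idem : T0O * T0O = T0O := by
  have h := gold_sq
  have : ![0,1,goldphi,0,0,0,0,0,0] ⬝ᵥ ![0,1,goldphi-1,0,0,0,0,0,0] = 2 := by
    simp [dotProduct, Fin.sum_univ_succ]; grind
  rw [T0O, Matrix.smul_mul, Matrix.mul_smul, Matrix.vecMulVec_mul, Matrix.vecMul_vecMulVec, this,
    Matrix.vecMulVec_smul, smul_smul, smul_smul]
  norm_num

/-- `κ = √5/2`. -/
noncomputable def kap : ℝ := (2 * goldphi - 1) / 2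

theorem kap_mul : kap * ((2 * goldphi - 1)/5) = 1/2 := by
  have h := gold_sq
  unfold kap; grind

theorem T0E_main (i j : Fin 9) (hj : j = 7 ∨ j = 8) : T0E i j = kap * Um i j := by
  have h : kap * Um i j = (kap * ((2 * goldphi - 1)/5)) *
      (Matrix.vecMulVec ![0,0,0,0,0,0,0,goldphi-1,1]
    ![1+goldphi,1+goldphi,1+goldphi,1,1,goldphi-1,0,goldphi,1] i j) := by
    rw [Um, Matrix.smul_apply, smul_eq_mul, mul_assoc]
  rw [h, kap_mul, T0E, Matrix.smul_apply, smul_eq_mul, Matrix.vecMulVec_apply,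
    Matrix.vecMulVec_apply]
  rcases hj with rfl | rfl <;> simp

theorem T0E_zero (i j : Fin 9) (h : ¬ (i = 7 ∨ i = 8) ∨ ¬ (j = 7 ∨ j = 8)) : T0E i j = 0 := by
  simp only [T0E, Matrix.smul_apply, Matrix.vecMulVec_apply]
  rcases h with h | h
  · revert h; fin_cases i <;> simp
  · revert h; fin_cases j <;> simp

theorem T0O_main (i j : Fin 9) (hj : j = 1 ∨ j = 2) : T0O i j = kap * Vm i j := by
  have h : kap * Vm i j = (kap * ((2 * goldphi - 1)/5)) *
      (Matrix.vecMulVec ![0,1,goldphi-1,0,0,0,0,0,0]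
    ![goldphi-1,1,goldphi,1+goldphi,1,0,1+goldphi,0,0] i j) := by
    rw [Vm, Matrix.smul_apply, smul_eq_mul, mul_assoc]
  rw [h, kap_mul, T0O, Matrix.smul_apply, smul_eq_mul, Matrix.vecMulVec_apply,
    Matrix.vecMulVec_apply]
  rcases hj with rfl | rfl <;> simp

theorem T0O_zero (i j : Fin 9) (h : ¬ (i = 1 ∨ i = 2) ∨ ¬ (j = 1 ∨ j = 2)) : T0O i j = 0 := by
  simp only [T0O, Matrix.smul_apply, Matrix.vecMulVec_apply]
  rcases h with h | h
  · revert h; fin_cases i <;> simp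
  · revert h; fin_cases j <;> simp

/-- Rescaled transition matrices. -/
noncomputable def scaled (D : ℕ → Fin 9 → ℝ) (S : ℕ → Matrix (Fin 9) (Fin 9) ℝ) (l : ℕ) :
    Matrix (Fin 9) (Fin 9) ℝ := Matrix.of fun i j => (D l i)⁻¹ * S l i j * D (l+1) j

theorem scaled_tail (D : ℕ → Fin 9 → ℝ) (hD : ∀ l i, D l i ≠ 0)
    (S : ℕ → Matrix (Fin 9) (Fin 9) ℝ) (N k : ℕ) :
    tailProd S N k * Matrix.diagonal (D (N + k))
      = Matrix.diagonal (D N) * tailProd (scaled D S) N k := by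
  have h1 : ∀ l, S l * Matrix.diagonal (D (l+1)) = Matrix.diagonal (D l) * scaled D S l := by
    intro l
    ext i j
    rw [Matrix.mul_diagonal, Matrix.diagonal_mul, scaled, Matrix.of_apply]
    have := hD l i
    field_simp
  induction k with
  | zero => simp [tailProd_zero]
  | succ k ih =>
    rw [tailProd_succ, tailProd_succ, ← add_assoc, mul_assoc, h1, ← mul_assoc, ih, mul_assoc]

theorem summable_half {f : ℕ → ℝ} (C : ℝ) (h0 : ∀ l, 0 ≤ f l) (h : ∀ l, f l ≤ C * (1/2)^l) :
    Summable f :=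
  Summable.of_nonneg_of_le h0 h
    ((summable_geometric_of_lt_one (by norm_num) (by norm_num)).mul_left C)

/-! ### Growth of the sequence -/

theorem good_growth (r : ℕ → ℕ) (hr : GoodSeq r) (n : ℕ) (hn : 1 ≤ n) :
    aseq r n + n ≤ aseq r (n+1) := by
  obtain ⟨h1, h2, h3⟩ := hr
  have hd : ∀ n, 1 ≤ n → n ≤ r (n+1) - r n := by
    intro n hn
    induction n, hn using Nat.le_induction with
    | base => simp [h1, h2]
    | succ n hn ih => have := h3 n hn; change n + 1 ≤ r (n+2) - r (n+1); omega
  have hp : ∀ n, 1 ≤ n → 1 ≤ r n := by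
    intro n hn
    induction n, hn using Nat.le_induction with
    | base => simp [h1]
    | succ n hn ih => have := hd n hn; omega
  have := hd n hn
  have := hp n hn
  unfold aseq; omega

/-- `φ^{2a_{2l+1}}`. -/
noncomputable def Xs (r : ℕ → ℕ) (l : ℕ) : ℝ := goldphi ^ (2 * aseq r (2*l+1))
/-- `φ^{2a_{2l+2}}`. -/
noncomputable def Ys (r : ℕ → ℕ) (l : ℕ) : ℝ := goldphi ^ (2 * aseq r (2*l+2))

theorem pow_growth (a b l : ℕ) (h : a + 2 * l ≤ b) :
    (4:ℝ)^l * goldphi ^ (2 * a) ≤ goldphi ^ (2 * b) := by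
  have hg := gold_gt
  have h4 : (4:ℝ) ≤ goldphi ^ 4 := by
    have h2 : 2 ≤ goldphi ^ 2 := by nlinarith
    nlinarith
  calc (4:ℝ)^l * goldphi ^ (2 * a) ≤ (goldphi ^ 4) ^ l * goldphi ^ (2 * a) := by
        gcongr
    _ = goldphi ^ (2 * (a + 2 * l)) := by rw [← pow_mul, ← pow_add]; congr 1; ring
    _ ≤ _ := pow_le_pow_right₀ (by linarith) (by omega)

theorem X_growth (r : ℕ → ℕ) (hr : GoodSeq r) (l : ℕ) : (4:ℝ)^l ≤ Xs r l := by
  have : 0 + 2 * l ≤ aseq r (2*l+1) := by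
    rcases Nat.eq_zero_or_pos l with rfl | hl
    · simp
    · have := good_growth r hr (2*l) (by omega); omega
  simpa [Xs] using pow_growth 0 _ l this

theorem Y_growth (r : ℕ → ℕ) (hr : GoodSeq r) (l : ℕ) : (4:ℝ)^l * Xs r l ≤ Ys r l := by
  apply pow_growth
  have := good_growth r hr (2*l+1) (by omega)
  simp only [add_assoc, Nat.reduceAdd] at this ⊢
  omega

theorem X'_growth (r : ℕ → ℕ) (hr : GoodSeq r) (l : ℕ) : (4:ℝ)^l * Ys r l ≤ Xs r (l+1) := by
  apply pow_growth
  have := good_growth r hr (2*l+2) (by omega)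
  rw [show 2 * (l+1) + 1 = 2*l+2+1 by ring]
  omega

/-- Scaling for the even mode. -/
noncomputable def DE (r : ℕ → ℕ) (l : ℕ) (i : Fin 9) : ℝ :=
  if i = 7 ∨ i = 8 then 1 else 2^l * (Xs r l)⁻¹

/-- Scaling for the odd mode. -/
noncomputable def DO (l : ℕ) (i : Fin 9) : ℝ :=
  if i = 1 ∨ i = 2 then 1 else (1/2)^l

/-- Normalised transition, even mode. -/
noncomputable def SE (r : ℕ → ℕ) (l : ℕ) : Matrix (Fin 9) (Fin 9) ℝ :=
  (cseq r (2*l+1))⁻¹ • Pmat r (2*l+1)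

/-- Normalised transition, odd mode. -/
noncomputable def SO (r : ℕ → ℕ) (l : ℕ) : Matrix (Fin 9) (Fin 9) ℝ :=
  (cseq r (2*l+2))⁻¹ • Pmat r (2*l+1)

theorem SE_apply (r : ℕ → ℕ) (l : ℕ) (i j : Fin 9) : SE r l i j = kap * (Xs r l)⁻¹ *
    (Zm i j + Xs r l * Um i j + (Xs r l)⁻¹ * Um' i j + Ys r l * Vm i j + (Ys r l)⁻¹ * Vm' i j) := by
  rw [SE, Matrix.smul_apply, P_apply, smul_eq_mul, cseq, sqrt5_eq, mul_inv, inv_div]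
  rfl

theorem SO_apply (r : ℕ → ℕ) (l : ℕ) (i j : Fin 9) : SO r l i j = kap * (Ys r l)⁻¹ *
    (Zm i j + Xs r l * Um i j + (Xs r l)⁻¹ * Um' i j + Ys r l * Vm i j + (Ys r l)⁻¹ * Vm' i j) := by
  rw [SO, Matrix.smul_apply, P_apply, smul_eq_mul, cseq, sqrt5_eq, mul_inv, inv_div]
  rfl

/-! ### Summability of the errors -/

theorem E_summable (r : ℕ → ℕ) (hr : GoodSeq r) (i j : Fin 9) :
    Summable (fun l => scaled (DE r) (SE r) l i j - T0E i j) := by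
  have hX := X_growth r hr
  have hY := Y_growth r hr
  have hX' := X'_growth r hr
  set X := Xs r with hXdef
  set Y := Ys r with hYdef
  have h4 : ∀ l : ℕ, (1:ℝ) ≤ 4^l := fun l => one_le_pow₀ (by norm_num)
  have hXp : ∀ l, 0 < X l := fun l => lt_of_lt_of_le (by positivity) (hX l)
  have hX1 : ∀ l, 1 ≤ X l := fun l => (h4 l).trans (hX l)
  have hYX : ∀ l, X l ≤ Y l := fun l =>
    (le_mul_of_one_le_left (hXp l).le (h4 l)).trans (hY l)
  have hYp : ∀ l, 0 < Y l := fun l => (hXp l).trans_le (hYX l)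
  have hh : ∀ l : ℕ, (0:ℝ) < (1/2)^l := fun l => by positivity
  have h42 : ∀ l : ℕ, (1/4:ℝ)^l ≤ (1/2)^l := fun l => by gcongr; norm_num
  have i4 : ∀ l, (X l)⁻¹ ≤ (1/4)^l := fun l => by
    rw [one_div, inv_pow]; exact inv_anti₀ (by positivity) (hX l)
  have i1 : ∀ l, (X l)⁻¹ ≤ 1 := fun l => inv_le_one_of_one_le₀ (hX1 l)
  have iy1 : ∀ l, (Y l)⁻¹ ≤ 1 := fun l => inv_le_one_of_one_le₀ ((hX1 l).trans (hYX l))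
  have ix0 : ∀ l, 0 < (X l)⁻¹ := fun l => inv_pos.2 (hXp l)
  have iy0 : ∀ l, 0 < (Y l)⁻¹ := fun l => inv_pos.2 (hYp l)
  have i2 : ∀ l, (X l)⁻¹ ≤ (1/2)^l := fun l => (i4 l).trans (h42 l)
  have iw : ∀ l, 2^l * (X l)⁻¹ ≤ (1/2)^l := fun l => by
    calc (2:ℝ)^l * (X l)⁻¹ ≤ 2^l * (1/4)^l := by gcongr; exact i4 l
      _ = (1/2)^l := by rw [← mul_pow]; norm_num
  have hs0 : Summable (fun l : ℕ => (1/2:ℝ)^l) :=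
    summable_geometric_of_lt_one (by norm_num) (by norm_num)
  have s1 : Summable (fun l => (X l)⁻¹) :=
    summable_half 1 (fun l => (ix0 l).le) (fun l => by rw [one_mul]; exact i2 l)
  have s1' : Summable (fun l => (X (l+1))⁻¹) := (summable_nat_add_iff 1).2 s1
  have sw : Summable (fun l => 2^l * (X l)⁻¹) :=
    summable_half 1 (fun l => by have := ix0 l; positivity) (fun l => by rw [one_mul]; exact iw l)
  have sw' : Summable (fun l => 2^(l+1) * (X (l+1))⁻¹) := (summable_nat_add_iff 1).2 sw
  have mulb : ∀ {f g : ℕ → ℝ}, Summable f → (∀ l, 0 ≤ f l) → (∀ l, 0 ≤ g l) → (∀ l, g l ≤ 1) →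
      Summable (fun l => f l * g l) := fun hf hf0 hg0 hg1 =>
    Summable.of_nonneg_of_le (fun l => mul_nonneg (hf0 l) (hg0 l))
      (fun l => mul_le_of_le_one_right (hf0 l) (hg1 l)) hf
  by_cases hi : i = 7 ∨ i = 8 <;> by_cases hj : j = 7 ∨ j = 8
  · have hi' : ¬ (i = 1 ∨ i = 2) := by rcases hi with rfl | rfl <;> decide
    have s2 := mulb s1 (fun l => (ix0 l).le) (fun l => (ix0 l).le) i1
    refine ((s1.mul_left (kap * Zm i j)).add (s2.mul_left (kap * Um' i j))).congr (fun l => ?_)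
    have := (hXp l).ne'
    simp only [scaled, Matrix.of_apply, SE_apply, DE, if_pos hi, if_pos hj, T0E_main i j hj,
      Vm_zero i j hi', Vm'_zero i j hi', ← hXdef, ← hYdef]
    field_simp
    ring
  · have hi' : ¬ (i = 1 ∨ i = 2) := by rcases hi with rfl | rfl <;> decide
    have w0 : ∀ l, 0 ≤ 2^(l+1) * (X (l+1))⁻¹ := fun l => by have := ix0 (l+1); positivity
    have s2 := mulb sw' w0 (fun l => (ix0 l).le) i1
    have s3 := mulb s2 (fun l => mul_nonneg (w0 l) (ix0 l).le) (fun l => (ix0 l).le) i1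
    refine (((sw'.mul_left (kap * Um i j)).add (s2.mul_left (kap * Zm i j))).add
      (s3.mul_left (kap * Um' i j))).congr (fun l => ?_)
    have := (hXp l).ne'
    have := (hXp (l+1)).ne'
    simp only [scaled, Matrix.of_apply, SE_apply, DE, if_pos hi, if_neg hj,
      T0E_zero i j (Or.inr hj),
      Vm_zero i j hi', Vm'_zero i j hi', ← hXdef, ← hYdef]
    field_simp
    ring
  · have s2 := mulb hs0 (fun l => (hh l).le) (fun l => (iy0 l).le) iy1
    refine ((hs0.mul_left (kap * Zm i j)).add (s2.mul_left (kap * Vm' i j))).congr (fun l => ?_)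
    have := (hXp l).ne'
    have := (hYp l).ne'
    simp only [scaled, Matrix.of_apply, SE_apply, DE, if_neg hi, if_pos hj,
      T0E_zero i j (Or.inl hi), Vm_col i j hj,
      Um_zero i j hi, Um'_zero i j hi, ← hXdef, ← hYdef, one_div, inv_pow]
    field_simp
    ring
  · have s2 := mulb s1' (fun l => (ix0 (l+1)).le) (fun l => (iy0 l).le) iy1
    have s3 : Summable (fun l => Y l * (X (l+1))⁻¹) := by
      refine summable_half 1 (fun l => mul_nonneg (hYp l).le (ix0 (l+1)).le) (fun l => ?_)
      rw [one_mul]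
      refine le_trans ?_ (h42 l)
      rw [one_div, inv_pow, mul_inv_le_iff₀ (hXp (l+1)), ← div_eq_inv_mul, le_div_iff₀ (by positivity)]
      rw [mul_comm]; exact hX' l
    refine (((s1'.mul_left (2 * kap * Zm i j)).add (s2.mul_left (2 * kap * Vm' i j))).add
      (s3.mul_left (2 * kap * Vm i j))).congr (fun l => ?_)
    have := (hXp l).ne'
    have := (hXp (l+1)).ne'
    have := (hYp l).ne'
    simp only [scaled, Matrix.of_apply, SE_apply, DE, if_neg hi, if_neg hj,
      T0E_zero i j (Or.inl hi),
      Um_zero i j hi, Um'_zero i j hi, ← hXdef, ← hYdef, pow_succ]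
    field_simp
    ring

theorem O_summable (r : ℕ → ℕ) (hr : GoodSeq r) (i j : Fin 9) :
    Summable (fun l => scaled DO (SO r) l i j - T0O i j) := by
  have hX := X_growth r hr
  have hY := Y_growth r hr
  set X := Xs r with hXdef
  set Y := Ys r with hYdef
  have h4 : ∀ l : ℕ, (1:ℝ) ≤ 4^l := fun l => one_le_pow₀ (by norm_num)
  have hXp : ∀ l, 0 < X l := fun l => lt_of_lt_of_le (by positivity) (hX l)
  have hX1 : ∀ l, 1 ≤ X l := fun l => (h4 l).trans (hX l)
  have hYX : ∀ l, X l ≤ Y l := fun l =>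
    (le_mul_of_one_le_left (hXp l).le (h4 l)).trans (hY l)
  have hYp : ∀ l, 0 < Y l := fun l => (hXp l).trans_le (hYX l)
  have i1 : ∀ l, (X l)⁻¹ ≤ 1 := fun l => inv_le_one_of_one_le₀ (hX1 l)
  have iy1 : ∀ l, (Y l)⁻¹ ≤ 1 := fun l => inv_le_one_of_one_le₀ ((hX1 l).trans (hYX l))
  have ix0 : ∀ l, 0 < (X l)⁻¹ := fun l => inv_pos.2 (hXp l)
  have iy0 : ∀ l, 0 < (Y l)⁻¹ := fun l => inv_pos.2 (hYp l)
  have hs0 : Summable (fun l : ℕ => (1/2:ℝ)^l) :=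
    summable_geometric_of_lt_one (by norm_num) (by norm_num)
  have hh : ∀ l : ℕ, (0:ℝ) < (1/2)^l := fun l => by positivity
  have hh1 : ∀ l : ℕ, (1/2:ℝ)^l ≤ 1 := fun l => pow_le_one₀ (by norm_num) (by norm_num)
  have mulb : ∀ {f g : ℕ → ℝ}, Summable f → (∀ l, 0 ≤ f l) → (∀ l, 0 ≤ g l) → (∀ l, g l ≤ 1) →
      Summable (fun l => f l * g l) := fun hf hf0 hg0 hg1 =>
    Summable.of_nonneg_of_le (fun l => mul_nonneg (hf0 l) (hg0 l))
      (fun l => mul_le_of_le_one_right (hf0 l) (hg1 l)) hf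
  -- the three basic coefficients
  have b0 : ∀ l, 0 ≤ 2^l * (X l * (Y l)⁻¹) := fun l => by
    have := hXp l; have := iy0 l; positivity
  have sb : Summable (fun l => 2^l * (X l * (Y l)⁻¹)) := by
    refine summable_half 1 b0 (fun l => ?_)
    have h1 : X l * (Y l)⁻¹ ≤ (1/4)^l := by
      rw [one_div, inv_pow, mul_inv_le_iff₀ (hYp l), ← div_eq_inv_mul, le_div_iff₀ (by positivity)]
      rw [mul_comm]; exact hY l
    calc (2:ℝ)^l * (X l * (Y l)⁻¹) ≤ 2^l * (1/4)^l := by gcongr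
      _ = 1 * (1/2)^l := by rw [← mul_pow]; norm_num
  have sa := mulb sb b0 (fun l => (ix0 l).le) i1
  have a0 : ∀ l, 0 ≤ 2^l * (X l * (Y l)⁻¹) * (X l)⁻¹ := fun l => mul_nonneg (b0 l) (ix0 l).le
  have sc := mulb sa a0 (fun l => (ix0 l).le) i1
  have sy : Summable (fun l => (Y l)⁻¹) := by
    refine (mulb sa a0 (fun l => (hh l).le) hh1).congr (fun l => ?_)
    have := (hXp l).ne'
    have := (hYp l).ne'
    rw [one_div, inv_pow]
    field_simp
  by_cases hi : i = 1 ∨ i = 2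
  · have hi' : ¬ (i = 7 ∨ i = 8) := by rcases hi with rfl | rfl <;> decide
    by_cases hj : j = 1 ∨ j = 2
    · have s2 := mulb sy (fun l => (iy0 l).le) (fun l => (iy0 l).le) iy1
      refine ((sy.mul_left (kap * Zm i j)).add (s2.mul_left (kap * Vm' i j))).congr (fun l => ?_)
      have := (hYp l).ne'
      simp only [scaled, Matrix.of_apply, SO_apply, DO, if_pos hi, if_pos hj, T0O_main i j hj,
        Um_zero i j hi', Um'_zero i j hi', ← hXdef, ← hYdef]
      field_simp
      ring
    · have s2 := mulb hs0 (fun l => (hh l).le) (fun l => (iy0 l).le) iy1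
      have s3 := mulb s2 (fun l => mul_nonneg (hh l).le (iy0 l).le) (fun l => (iy0 l).le) iy1
      refine (((hs0.mul_left (1/2 * kap * Vm i j)).add (s2.mul_left (1/2 * kap * Zm i j))).add
        (s3.mul_left (1/2 * kap * Vm' i j))).congr (fun l => ?_)
      have := (hYp l).ne'
      simp only [scaled, Matrix.of_apply, SO_apply, DO, if_pos hi, if_neg hj,
        T0O_zero i j (Or.inr hj),
        Um_zero i j hi', Um'_zero i j hi', ← hXdef, ← hYdef, pow_succ]
      field_simp
      ring
  · by_cases hj : j = 1 ∨ j = 2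
    · refine (((sa.mul_left (kap * Zm i j)).add (sb.mul_left (kap * Um i j))).add
        (sc.mul_left (kap * Um' i j))).congr (fun l => ?_)
      have := (hXp l).ne'
      have := (hYp l).ne'
      simp only [scaled, Matrix.of_apply, SO_apply, DO, if_neg hi, if_pos hj,
        T0O_zero i j (Or.inl hi),
        Vm_zero i j hi, Vm'_zero i j hi, ← hXdef, ← hYdef, one_div, inv_pow, inv_inv]
      field_simp
      ring
    · have ta := mulb sa a0 (fun l => (hh l).le) hh1
      have tb := mulb sb b0 (fun l => (hh l).le) hh1
      have tc := mulb sc (fun l => mul_nonneg (a0 l) (ix0 l).le) (fun l => (hh l).le) hh1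
      refine (((ta.mul_left (1/2 * kap * Zm i j)).add (tb.mul_left (1/2 * kap * Um i j))).add
        (tc.mul_left (1/2 * kap * Um' i j))).congr (fun l => ?_)
      have := (hXp l).ne'
      have := (hYp l).ne'
      simp only [scaled, Matrix.of_apply, SO_apply, DO, if_neg hi, if_neg hj,
        T0O_zero i j (Or.inl hi), pow_succ,
        Vm_zero i j hi, Vm'_zero i j hi, ← hXdef, ← hYdef, one_div, inv_pow, inv_inv]
      field_simp
      ring

/-! ### Assembling -/

theorem det_A : IsUnit Amat := by
  have h : Amat * !![1,0,0,0,0,0,0,0,0;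
     0,1,0,0,0,0,0,0,0;
     0,0,1,0,0,0,0,0,0;
     0,0,0,1,0,0,0,0,0;
     0,0,0,0,1,0,0,0,0;
     0,0,0,0,0,1,0,0,0;
     0,0,0,0,0,0,1,0,0;
     0,0,0,1,1,0,-2,2,-1;
     0,0,0,-1,-1,-1,1,-1,1] = 1 := by
    ext i j
    fin_cases i <;> fin_cases j <;>
      simp [Amat, Matrix.mul_apply, Fin.sum_univ_succ] <;> norm_num
  exact IsUnit.of_mul_eq_one _ h

theorem det_M : IsUnit Mmat := by
  have h : Mmat * !![0,0,0,0,0,0,1,-1,0;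
     0,0,0,1,0,0,0,0,0;
     0,0,0,0,0,0,0,1,0;
     0,0,0,0,0,0,0,0,1;
     0,0,0,0,1,0,0,0,-1;
     1,0,0,0,0,0,0,0,0;
     0,0,0,0,0,1,0,0,0;
     0,0,1,0,0,0,0,0,0;
     0,1,0,0,0,0,0,0,0] = 1 := by
    ext i j
    fin_cases i <;> fin_cases j <;>
      simp [Mmat, Matrix.mul_apply, Fin.sum_univ_succ]
  exact IsUnit.of_mul_eq_one _ h

theorem unit_P (r : ℕ → ℕ) (n : ℕ) : IsUnit (Pmat r n) :=
  (((det_A.pow _).mul det_M).mul (det_A.pow _)).mul det_M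

theorem unit_tail (r : ℕ → ℕ) (N k : ℕ) : IsUnit (tailProd (fun l => Pmat r (2*l+1)) N k) := by
  induction k with
  | zero => rw [tailProd_zero]; exact isUnit_one
  | succ k ih => rw [tailProd_succ]; exact ih.mul (unit_P r _)

theorem tail_smul (c : ℕ → ℝ) (P : ℕ → Matrix (Fin 9) (Fin 9) ℝ) (N : ℕ) :
    tailProd (fun l => (c l)⁻¹ • P l) 0 N
      = (∏ l ∈ Finset.range N, c l)⁻¹ • tailProd P 0 N := by
  induction N with
  | zero => simp [tailProd_zero]
  | succ N ih =>
    rw [tailProd_succ, ih, tailProd_succ, Finset.prod_range_succ, mul_inv, zero_add,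
      Matrix.smul_mul, Matrix.mul_smul, smul_smul]

/-- From convergence of the rescaled products to convergence of the original vectors. -/
theorem limit_of_scaled (c : ℕ → ℝ) (P : ℕ → Matrix (Fin 9) (Fin 9) ℝ) (D : ℕ → Fin 9 → ℝ)
    (hD : ∀ l i, D l i ≠ 0) (q : Fin 9) (hq : ∀ l, D l q = 1) (N : ℕ) (w : Fin 9 → ℝ)
    (hw : ∀ i, Tendsto (fun k => tailProd (scaled D (fun l => (c l)⁻¹ • P l)) N k i q) atTop
      (nhds (w i))) :
    Tendsto (fun n => (∏ l ∈ Finset.range n, c l)⁻¹ •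
          (((List.range n).map P).prod).mulVec (Pi.single q (1 : ℝ))) atTop
      (nhds ((∏ l ∈ Finset.range N, c l)⁻¹ • (tailProd P 0 N).mulVec (fun i => D N i * w i))) := by
  rw [← tendsto_add_atTop_iff_nat N]
  have key : ∀ k, (∏ l ∈ Finset.range (k + N), c l)⁻¹ •
          (((List.range (k + N)).map P).prod).mulVec (Pi.single q (1 : ℝ))
      = (∏ l ∈ Finset.range N, c l)⁻¹ • (tailProd P 0 N).mulVec
        (fun i => D N i * tailProd (scaled D (fun l => (c l)⁻¹ • P l)) N k i q) := by
    intro k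
    have h0 : ((List.range (k + N)).map P).prod = tailProd P 0 (N + k) := by
      simp [tailProd, add_comm]
    rw [h0, ← Matrix.smul_mulVec, add_comm k N, ← tail_smul, tailProd_add, tail_smul,
      ← Matrix.mulVec_mulVec, Matrix.smul_mulVec]
    congr 2
    have h1 := scaled_tail D hD (fun l => (c l)⁻¹ • P l) N k
    ext i
    have h2 := congrFun (congrFun h1 i) q
    rw [Matrix.mul_diagonal, Matrix.diagonal_mul, hq, mul_one] at h2
    rw [← h2]
    simp
  simp_rw [key]
  refine Tendsto.const_smul ?_ _
  have hc : Continuous (fun v : Fin 9 → ℝ => (tailProd P 0 N).mulVec v) :=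
    continuous_const.matrix_mulVec continuous_id
  refine (hc.tendsto _).comp ?_
  rw [tendsto_pi_nhds]
  exact fun i => (hw i).const_mul _

/-- The limits `v_even` and `v_odd` exist, are nonzero, and are linearly independent. -/
theorem stmt9 (r : ℕ → ℕ) (hr : GoodSeq r) :
    ∃ vEven vOdd : Fin 9 → ℝ,
      Tendsto
        (fun n => (∏ l ∈ Finset.range n, cseq r (2*l+1))⁻¹ •
          (((List.range n).map (fun l => Pmat r (2*l+1))).prod).mulVec
            (Pi.single (8 : Fin 9) (1 : ℝ)))
        atTop (nhds vEven) ∧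
      Tendsto
        (fun n => (∏ l ∈ Finset.range n, cseq r (2*l+2))⁻¹ •
          (((List.range n).map (fun l => Pmat r (2*l+1))).prod).mulVec
            (Pi.single (1 : Fin 9) (1 : ℝ)))
        atTop (nhds vOdd) ∧
      vEven ≠ 0 ∧ vOdd ≠ 0 ∧ LinearIndependent ℝ ![vEven, vOdd] := by
  obtain ⟨WE, hE1, hE2⟩ := tailProd_matrix (scaled (DE r) (SE r)) T0E T0E_idem (E_summable r hr)
  obtain ⟨WO, hO1, hO2⟩ := tailProd_matrix (scaled DO (SO r)) T0O T0O_idem (O_summable r hr)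
  have hX := X_growth r hr
  have hXp : ∀ l, 0 < Xs r l := fun l => lt_of_lt_of_le (by positivity) (hX l)
  have hDE : ∀ l i, DE r l i ≠ 0 := by
    intro l i
    have := hXp l
    unfold DE; split_ifs <;> positivity
  have hDO : ∀ l i, DO l i ≠ 0 := by
    intro l i
    unfold DO; split_ifs <;> positivity
  have hDE1 : ∀ l, DE r l 1 ≤ 1 ∧ 0 ≤ DE r l 1 := by
    intro l
    have hp := hXp l
    have : DE r l 1 = 2^l * (Xs r l)⁻¹ := by unfold DE; rw [if_neg (by decide)]
    rw [this]
    refine ⟨?_, by positivity⟩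
    rw [mul_inv_le_iff₀ hp, one_mul]
    refine le_trans ?_ (hX l)
    gcongr; norm_num
  have hDO8 : ∀ l, DO l 8 ≤ 1 ∧ 0 ≤ DO l 8 := by
    intro l
    have : DO l 8 = (1/2)^l := by unfold DO; rw [if_neg (by decide)]
    rw [this]
    exact ⟨pow_le_one₀ (by norm_num) (by norm_num), by positivity⟩
  have hDE8 : ∀ l, DE r l 8 = 1 := fun l => by simp [DE]
  have hDO1 : ∀ l, DO l 1 = 1 := fun l => by simp [DO]
  -- the minor
  have hminor : Tendsto (fun N => WE N 8 8 * WO N 1 1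
      - (DE r N 1 * DO N 8) * (WE N 1 8 * WO N 8 1)) atTop (nhds (1/4)) := by
    have e1 : T0E 8 8 = 1/2 := by 
      rw [T0E, Matrix.smul_apply, Matrix.vecMulVec_apply]; simp
    have e2 : T0O 1 1 = 1/2 := by 
      rw [T0O, Matrix.smul_apply, Matrix.vecMulVec_apply]; simp
    have e3 : T0E 1 8 = 0 := T0E_zero _ _ (Or.inl (by decide))
    have e4 : T0O 8 1 = 0 := T0O_zero _ _ (Or.inl (by decide))
    have t1 := (hE2 8 8).mul (hO2 1 1)
    have t2 := (hE2 1 8).mul (hO2 8 1)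
    rw [e1, e2] at t1
    rw [e3, e4, mul_zero] at t2
    have t3 : Tendsto (fun N => (DE r N 1 * DO N 8) * (WE N 1 8 * WO N 8 1)) atTop (nhds 0) := by
      have t4 := t2.abs
      rw [abs_zero] at t4
      refine squeeze_zero_norm (fun N => ?_) t4
      rw [Real.norm_eq_abs, abs_mul]
      refine mul_le_of_le_one_left (abs_nonneg _) ?_
      rw [abs_of_nonneg (mul_nonneg (hDE1 N).2 (hDO8 N).2)]
      exact mul_le_one₀ (hDE1 N).1 (hDO8 N).2 (hDO8 N).1
    have := t1.sub t3
    rw [show (1/2 : ℝ) * (1/2) - 0 = 1/4 by norm_num] at this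
    exact this
  obtain ⟨N, hN⟩ := (hminor.eventually_ne (by norm_num : (1/4:ℝ) ≠ 0)).exists
  have hSE : SE r = fun l => (cseq r (2*l+1))⁻¹ • Pmat r (2*l+1) := rfl
  have hSO : SO r = fun l => (cseq r (2*l+2))⁻¹ • Pmat r (2*l+1) := rfl
  rw [hSE] at hE1
  rw [hSO] at hO1
  have hLE := limit_of_scaled (fun l => cseq r (2*l+1)) (fun l => Pmat r (2*l+1)) (DE r) hDE 8
    hDE8 N (fun i => WE N i 8) (fun i => hE1 N i 8)
  have hLO := limit_of_scaled (fun l => cseq r (2*l+2)) (fun l => Pmat r (2*l+1)) DO hDO 1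
    hDO1 N (fun i => WO N i 1) (fun i => hO1 N i 1)
  have hcp : ∀ n, cseq r n ≠ 0 := by
    intro n
    have := gold_gt
    unfold cseq; positivity
  set G := tailProd (fun l => Pmat r (2*l+1)) 0 N with hG
  have hGinj : ∀ v, G.mulVec v = 0 → v = 0 := by
    intro v hv
    exact Matrix.mulVec_injective_of_isUnit (unit_tail r 0 N) (by rw [hv, Matrix.mulVec_zero])
  set α := (∏ l ∈ Finset.range N, cseq r (2*l+1))⁻¹ with hα
  set β := (∏ l ∈ Finset.range N, cseq r (2*l+2))⁻¹ with hβ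
  have hα0 : α ≠ 0 := inv_ne_zero (Finset.prod_ne_zero_iff.2 fun l _ => hcp _)
  have hβ0 : β ≠ 0 := inv_ne_zero (Finset.prod_ne_zero_iff.2 fun l _ => hcp _)
  have hLI : LinearIndependent ℝ ![α • G.mulVec (fun i => DE r N i * WE N i 8),
      β • G.mulVec (fun i => DO N i * WO N i 1)] := by
    rw [LinearIndependent.pair_iff]
    intro s t hst
    have h1 : G.mulVec ((s * α) • (fun i => DE r N i * WE N i 8)
        + (t * β) • (fun i => DO N i * WO N i 1)) = 0 := by
      rw [Matrix.mulVec_add, Matrix.mulVec_smul, Matrix.mulVec_smul, ← smul_smul, ← smul_smul]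
      exact hst
    have h2 := hGinj _ h1
    have c8 := congrFun h2 8
    have c1 := congrFun h2 1
    simp only [Pi.add_apply, Pi.smul_apply, smul_eq_mul, Pi.zero_apply, hDE8, hDO1, one_mul]
      at c8 c1
    have d1 : (s * α) * (WE N 8 8 * WO N 1 1
      - (DE r N 1 * DO N 8) * (WE N 1 8 * WO N 8 1)) = 0 := by
      linear_combination WO N 1 1 * c8 - DO N 8 * WO N 8 1 * c1
    have d2 : (t * β) * (WE N 8 8 * WO N 1 1
      - (DE r N 1 * DO N 8) * (WE N 1 8 * WO N 8 1)) = 0 := by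
      linear_combination WE N 8 8 * c1 - DE r N 1 * WE N 1 8 * c8
    constructor
    · simpa [hN, hα0] using d1
    · simpa [hN, hβ0] using d2
  refine ⟨_, _, hLE, hLO, ?_, ?_, hLI⟩
  · exact hLI.ne_zero 0
  · exact hLI.ne_zero 1
end

section
/- For every i ≥ 1, c_{2i+1} > φ^{2i+1} · (c_2·c_4·⋯·c_{2i})/(c_1·c_3·⋯·c_{2i−1}). -/
open Filter Finset Matrix

theorem goldphi_gt : (1.6:ℝ) < goldphi := by
  have : (2.2:ℝ) < Real.sqrt 5 := Real.lt_sqrt_of_sq_lt (by norm_num)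
  unfold goldphi; linarith

theorem cseq_pos' (r : ℕ → ℕ) (n : ℕ) : 0 < cseq r n := by
  have := goldphi_gt
  have h : 0 < goldphi := by linarith
  unfold cseq; positivity

theorem good_diff (r : ℕ → ℕ) (hr : GoodSeq r) (n : ℕ) :
    1 ≤ r (n+1) ∧ n + 1 ≤ r (n+2) - r (n+1) := by
  obtain ⟨h1, h2, h3⟩ := hr
  induction n with
  | zero => simp [h1, h2]
  | succ k ih =>
    have := h3 (k+1) (by omega)
    simp only [add_assoc] at *
    norm_num at *
    omega

theorem cseq_step (r : ℕ → ℕ) (hr : GoodSeq r) (n : ℕ) :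
    cseq r (n+2) = cseq r (n+1) * goldphi ^ (2 * (r (n+2) - r (n+1))) := by
  have := good_diff r hr n
  unfold cseq aseq
  rw [mul_assoc, ← pow_add]
  congr 2
  omega

/-- `c_{2i+1} > φ^{2i+1} · (c_2 c_4 ⋯ c_{2i}) / (c_1 c_3 ⋯ c_{2i−1})` for all `i ≥ 1`. -/
theorem stmt12 (r : ℕ → ℕ) (hr : GoodSeq r) :
    ∀ i : ℕ, 1 ≤ i →
      cseq r (2*i+1) > goldphi ^ (2*i+1) *
        ((∏ l ∈ Finset.range i, cseq r (2*l+2)) / (∏ l ∈ Finset.range i, cseq r (2*l+1))) := by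
  have hg := goldphi_gt
  have hg0 : 0 < goldphi := by linarith
  have hg1 : 1 ≤ goldphi := by linarith
  intro i hi
  induction i, hi using Nat.le_induction with
  | base =>
    have e1 := cseq_step r hr 0
    have e2 := cseq_step r hr 1
    have d := (good_diff r hr 1).2
    have p1 := cseq_pos' r 1
    have p2 := cseq_pos' r 2
    norm_num at e1 e2 d
    have c1 : cseq r 1 = 2 / Real.sqrt 5 := by simp [cseq, aseq, hr.1]
    have hs : Real.sqrt 5 < 2.3 := (Real.sqrt_lt' (by norm_num)).2 (by norm_num)
    have hs0 : 0 < Real.sqrt 5 := by positivity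
    have hc : 1 < goldphi * cseq r 1 := by
      rw [c1, ← mul_div_assoc, lt_div_iff₀ hs0]; linarith
    have hp : goldphi ^ 4 ≤ goldphi ^ (2 * (r 3 - r 2)) :=
      pow_le_pow_right₀ hg1 (by omega)
    norm_num
    rw [← mul_div_assoc, div_lt_iff₀ p1, e2]
    calc goldphi ^ 3 * cseq r 2 < (goldphi ^ 3 * cseq r 2) * (goldphi * cseq r 1) :=
          lt_mul_of_one_lt_right (by positivity) hc
      _ = cseq r 2 * goldphi ^ 4 * cseq r 1 := by ring
      _ ≤ _ := by gcongr
  | succ i hi ih =>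
    rw [Finset.prod_range_succ, Finset.prod_range_succ]
    have e1 := cseq_step r hr (2*i)
    have e2 := cseq_step r hr (2*i+1)
    have d := (good_diff r hr (2*i+1)).2
    have p1 := cseq_pos' r (2*i+1)
    have hp : goldphi ^ 2 ≤ goldphi ^ (2 * (r (2*i+1+2) - r (2*i+1+1))) :=
      pow_le_pow_right₀ hg1 (by omega)
    rw [show 2*(i+1)+1 = 2*i+1+2 by ring, e2, show 2*i+1+1 = 2*i+2 by ring, e1, mul_div_mul_comm,
      mul_div_cancel_left₀ _ p1.ne']
    generalize (∏ l ∈ Finset.range i, cseq r (2*l+2)) / (∏ l ∈ Finset.range i, cseq r (2*l+1)) = Q at *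
    rw [show 2*i+1+1 = 2*i+2 by ring] at hp
    set X := goldphi ^ (2 * (r (2*i+2) - r (2*i+1)))
    have hX : 0 < X := by positivity
    calc goldphi ^ (2*i+1+2) * (Q * X) = (goldphi ^ (2*i+1) * Q) * X * goldphi ^ 2 := by ring
      _ < cseq r (2*i+1) * X * goldphi ^ 2 := by gcongr
      _ ≤ _ := by gcongr
end
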